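/- Let f : ℝⁿ → ℝ be a continuous function whose graph is contained in the zero set of a nonzero polynomial P ∈ ℝ[X₁,…,Xₙ,Y] such that for every x ∈ ℝⁿ the univariate polynomial P(x, ·) is nonzero. Then f is semialgebraic. -/

import Mathlib

/-- Semialgebraic subsets of `ℝⁿ`: the boolean algebra generated by zero sets and
positivity sets of real polynomials in `n` variables. -/
inductive IsSemialgebraic {n : ℕ} : Set (Fin n → ℝ) → Prop
  | zero_set (p : MvPolynomial (Fin n) ℝ) :
      IsSemialgebraic {x | MvPolynomial.eval x p = 0}
  | pos_set (p : MvPolynomial (Fin n) ℝ) :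
      IsSemialgebraic {x | 0 < MvPolynomial.eval x p}
  | union {s t : Set (Fin n → ℝ)} :
      IsSemialgebraic s → IsSemialgebraic t → IsSemialgebraic (s ∪ t)
  | compl {s : Set (Fin n → ℝ)} : IsSemialgebraic s → IsSemialgebraic sᶜ

/-- The graph of `f` over `X ⊆ ℝⁿ`, as a subset of `ℝⁿ⁺¹`. -/
def graphOn {n : ℕ} (f : (Fin n → ℝ) → ℝ) (X : Set (Fin n → ℝ)) :
    Set (Fin (n + 1) → ℝ) :=
  {z | ∃ x ∈ X, z = Fin.snoc x (f x)}

section PseudoDivision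

open Polynomial

theorem exists_pseudoRem {R : Type*} [CommRing R] (q : R[X]) (hq : 0 < q.natDegree) (p : R[X]) :
    ∃ r : R[X], r.natDegree < q.natDegree ∧
      ∃ (k : ℕ) (a : R[X]), C q.leadingCoeff ^ k * p = q * a + r := by
  induction hm : p.natDegree using Nat.strong_induction_on generalizing p with
  | _ m ih =>
    by_cases hlt : p.natDegree < q.natDegree
    · exact ⟨p, hlt, 0, 0, by simp⟩
    · have hle : q.natDegree ≤ m := by omega
      set b : R[X] := C p.leadingCoeff * X ^ (m - q.natDegree) with hb
      set p₁ : R[X] := C q.leadingCoeff * p - q * b with hp₁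
      have hbdeg : b.natDegree ≤ m - q.natDegree := natDegree_C_mul_X_pow_le _ _
      have hdeg : p₁.natDegree ≤ m := by
        refine (natDegree_sub_le _ _).trans (max_le ?_ ?_)
        · exact (natDegree_C_mul_le _ _).trans hm.le
        · exact natDegree_mul_le.trans (by omega)
      have hcoeff : p₁.coeff m = 0 := by
        have h1 : (q * b).coeff m = q.leadingCoeff * p.leadingCoeff := by
          have := coeff_mul_add_eq_of_natDegree_le (le_refl q.natDegree) hbdeg
          rw [Nat.add_sub_cancel' hle] at this
          rw [this, hb]
          simp
        rw [hp₁, coeff_sub, h1, coeff_C_mul, ← hm]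
        simp
      have hlt' : p₁.natDegree < m := by
        refine lt_of_le_of_ne hdeg fun h => ?_
        have h0 : p₁ = 0 := by
          rw [← leadingCoeff_eq_zero, leadingCoeff, h, hcoeff]
        rw [h0, natDegree_zero] at h
        omega
      obtain ⟨r, hr, k, a, h⟩ := ih _ hlt' p₁ rfl
      refine ⟨r, hr, k + 1, a + C q.leadingCoeff ^ k * b, ?_⟩
      have : C q.leadingCoeff ^ (k + 1) * p
          = C q.leadingCoeff ^ k * p₁ + q * (C q.leadingCoeff ^ k * b) := by
        rw [hp₁]; ring
      rw [this, h]
      ring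

/-- A remainder of `p` modulo `q` after multiplication by a power of the leading coefficient
of `q`; it is `0` when `q` is constant. -/
noncomputable def pseudoRem {R : Type*} [CommRing R] (p q : R[X]) : R[X] :=
  if hq : 0 < q.natDegree then (exists_pseudoRem q hq p).choose else 0

theorem natDegree_pseudoRem_lt {R : Type*} [CommRing R] (p : R[X]) {q : R[X]}
    (hq : 0 < q.natDegree) : (pseudoRem p q).natDegree < q.natDegree := by
  rw [pseudoRem, dif_pos hq]
  exact (exists_pseudoRem q hq p).choose_spec.1

theorem pseudoRem_spec {R : Type*} [CommRing R] (p : R[X]) {q : R[X]} (hq : 0 < q.natDegree) :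
    ∃ (k : ℕ) (a : R[X]), C q.leadingCoeff ^ k * p = q * a + pseudoRem p q := by
  rw [pseudoRem, dif_pos hq]
  exact (exists_pseudoRem q hq p).choose_spec.2

/-- The polynomials obtained from members of `s` by one differentiation, one removal of the
leading term, or one pseudo-division. -/
def reducts {R : Type*} [CommRing R] (s : Set R[X]) : Set R[X] :=
  {r | (∃ p ∈ s, 0 < p.natDegree ∧ (r = derivative p ∨ r = p.eraseLead)) ∨
    ∃ p ∈ s, ∃ q ∈ s, 0 < q.natDegree ∧ q.natDegree ≤ p.natDegree ∧ r = pseudoRem p q}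

theorem reducts_mono {R : Type*} [CommRing R] {s t : Set R[X]} (h : s ⊆ t) :
    reducts s ⊆ reducts t := by
  rintro r (⟨p, hp, h'⟩ | ⟨p, hp, q, hq, h'⟩)
  · exact Or.inl ⟨p, h hp, h'⟩
  · exact Or.inr ⟨p, h hp, q, h hq, h'⟩

theorem natDegree_eraseLead_lt_of_pos {R : Type*} [CommRing R] {p : R[X]}
    (hp : 0 < p.natDegree) : p.eraseLead.natDegree < p.natDegree := by
  have := eraseLead_natDegree_le p
  omega

theorem mem_reducts_sep_natDegree_lt {R : Type*} [CommRing R] {s : Set R[X]} {r : R[X]}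
    (hr : r ∈ reducts s) : r ∈ reducts {p ∈ s | r.natDegree < p.natDegree} := by
  rcases hr with ⟨p, hp, h0, rfl | rfl⟩ | ⟨p, hp, q, hq, h0, hle, rfl⟩
  · exact Or.inl ⟨p, ⟨hp, natDegree_derivative_lt h0.ne'⟩, h0, Or.inl rfl⟩
  · exact Or.inl ⟨p, ⟨hp, natDegree_eraseLead_lt_of_pos h0⟩, h0, Or.inr rfl⟩
  · have h := natDegree_pseudoRem_lt p h0
    exact Or.inr ⟨p, ⟨hp, h.trans_le hle⟩, q, ⟨hq, h⟩, h0, hle, rfl⟩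

theorem finite_reducts {R : Type*} [CommRing R] {s : Set R[X]} (hs : s.Finite) :
    (reducts s).Finite := by
  refine (((hs.image derivative).union (hs.image eraseLead)).union
    (hs.image2 pseudoRem hs)).subset ?_
  rintro r (⟨p, hp, h0, rfl | rfl⟩ | ⟨p, hp, q, hq, h0, hle, rfl⟩)
  · exact Or.inl (Or.inl ⟨p, hp, rfl⟩)
  · exact Or.inl (Or.inr ⟨p, hp, rfl⟩)
  · exact Or.inr ⟨p, hp, q, hq, rfl⟩

theorem exists_finite_reducts_subset_of_natDegree_lt {R : Type*} [CommRing R] (d : ℕ)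
    (K L : Set R[X]) (hK : K.Finite) (hL : L.Finite) (hLd : ∀ p ∈ L, p.natDegree < d)
    (hred : ∀ r ∈ reducts K, d ≤ r.natDegree → r ∈ K) :
    ∃ F : Set R[X], F.Finite ∧ K ∪ L ⊆ F ∧ reducts F ⊆ F := by
  induction d generalizing K L with
  | zero =>
    refine ⟨K, hK, ?_, fun r hr => hred r hr (Nat.zero_le _)⟩
    rintro p (hp | hp)
    · exact hp
    · exact absurd (hLd p hp) (Nat.not_lt_zero _)
  | succ d ih =>
    obtain ⟨F, hF, hsub, hcl⟩ := ih (K ∪ {p ∈ L ∪ reducts K | p.natDegree = d})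
      {p ∈ L | p.natDegree < d}
      (hK.union ((hL.union (finite_reducts hK)).subset (Set.sep_subset _ _)))
      (hL.subset (Set.sep_subset _ _)) (fun p hp => hp.2) (by
        intro r hr hd
        have hr' : r ∈ reducts K := by
          refine reducts_mono ?_ (mem_reducts_sep_natDegree_lt hr)
          rintro p ⟨hp | hp, hlt⟩
          · exact hp
          · exact absurd hp.2 (by omega)
        rcases hd.eq_or_lt with h | h
        · exact Or.inr ⟨Or.inr hr', h.symm⟩
        · exact Or.inl (hred r hr' h))
    refine ⟨F, hF, ?_, hcl⟩
    rintro p (hp | hp)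
    · exact hsub (Or.inl (Or.inl hp))
    · rcases (Nat.lt_succ_iff.1 (hLd p hp)).eq_or_lt with h | h
      · exact hsub (Or.inl (Or.inr ⟨Or.inl hp, h⟩))
      · exact hsub (Or.inr ⟨hp, h⟩)

theorem exists_finite_reducts_subset {R : Type*} [CommRing R] {L : Set R[X]} (hL : L.Finite) :
    ∃ F : Set R[X], F.Finite ∧ L ⊆ F ∧ reducts F ⊆ F := by
  obtain ⟨d, hd⟩ := (hL.image natDegree).bddAbove
  obtain ⟨F, hF, hsub, hcl⟩ := exists_finite_reducts_subset_of_natDegree_lt (d + 1) ∅ L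
    Set.finite_empty hL (fun p hp => Nat.lt_succ_iff.2 (hd ⟨p, hp, rfl⟩)) (by
      rintro r (⟨p, hp, -⟩ | ⟨p, hp, -⟩) <;> exact hp.elim)
  exact ⟨F, hF, (Set.subset_union_right).trans hsub, hcl⟩

end PseudoDivision

section Interval

open Polynomial Filter Topology

/-- The real points strictly between two extended reals. -/
def slice (a b : EReal) : Set ℝ := {y | a < y ∧ (y : EReal) < b}

theorem ordConnected_slice (a b : EReal) : (slice a b).OrdConnected :=
  ⟨fun _ hx _ hy _ hz => ⟨hx.1.trans_le (EReal.coe_le_coe_iff.2 hz.1),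
    (EReal.coe_le_coe_iff.2 hz.2).trans_lt hy.2⟩⟩

theorem isOpen_slice (a b : EReal) : IsOpen (slice a b) :=
  (isOpen_lt continuous_const continuous_coe_real_ereal).inter
    (isOpen_lt continuous_coe_real_ereal continuous_const)

theorem slice_nonempty {a b : EReal} (h : a < b) : (slice a b).Nonempty :=
  let ⟨y, h1, h2⟩ := EReal.lt_iff_exists_real_btwn.1 h
  ⟨y, h1, h2⟩

theorem infinite_slice {a b : EReal} (h : a < b) : (slice a b).Infinite := by
  obtain ⟨y, hy⟩ := slice_nonempty h
  exact infinite_of_mem_nhds y ((isOpen_slice a b).mem_nhds hy)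

theorem eval_lt_eval_of_derivative_pos {p : ℝ[X]} {a b : ℝ} (hab : a < b)
    (h : ∀ y ∈ Set.Ioo a b, 0 < p.derivative.eval y) : p.eval a < p.eval b := by
  refine strictMonoOn_of_deriv_pos (convex_Icc a b) p.continuous.continuousOn ?_
    (Set.left_mem_Icc.2 hab.le) (Set.right_mem_Icc.2 hab.le) hab
  intro y hy
  rw [interior_Icc] at hy
  rw [Polynomial.deriv]
  exact h y hy

theorem strictMonoOn_slice {p : ℝ[X]} {a b : EReal}
    (h : ∀ y ∈ slice a b, 0 < p.derivative.eval y) :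
    StrictMonoOn (fun y => p.eval y) (slice a b) := fun _ hx _ hy hxy =>
  eval_lt_eval_of_derivative_pos hxy fun _ hz =>
    h _ ((ordConnected_slice a b).out hx hy (Set.Ioo_subset_Icc_self hz))

theorem eval_left_lt_of_derivative_pos {p : ℝ[X]} {a : ℝ} {b : EReal}
    (h : ∀ y ∈ slice a b, 0 < p.derivative.eval y) {y : ℝ} (hy : y ∈ slice a b) :
    p.eval a < p.eval y :=
  eval_lt_eval_of_derivative_pos (EReal.coe_lt_coe_iff.1 hy.1) fun _ hz =>
    h _ ⟨EReal.coe_lt_coe_iff.2 hz.1, (EReal.coe_lt_coe_iff.2 hz.2).trans hy.2⟩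

theorem eval_lt_right_of_derivative_pos {p : ℝ[X]} {a : EReal} {b : ℝ}
    (h : ∀ y ∈ slice a b, 0 < p.derivative.eval y) {y : ℝ} (hy : y ∈ slice a b) :
    p.eval y < p.eval b :=
  eval_lt_eval_of_derivative_pos (EReal.coe_lt_coe_iff.1 hy.2) fun _ hz =>
    h _ ⟨hy.1.trans (EReal.coe_lt_coe_iff.2 hz.1), EReal.coe_lt_coe_iff.2 hz.2⟩

theorem exists_eval_neg_of_left_neg {p : ℝ[X]} {a : ℝ} {b : EReal} (hab : (a : EReal) < b)
    (ha : p.eval a < 0) : ∃ y ∈ slice a b, p.eval y < 0 := by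
  have h1 : ∀ᶠ y in 𝓝[>] a, p.eval y < 0 :=
    (p.continuous.continuousAt.eventually_lt_const ha).filter_mono nhdsWithin_le_nhds
  have h2 : ∀ᶠ y : ℝ in 𝓝[>] a, (y : EReal) < b :=
    (continuous_coe_real_ereal.continuousAt.eventually_lt_const hab).filter_mono
      nhdsWithin_le_nhds
  obtain ⟨y, hy1, hy2, hy3⟩ := (h1.and (h2.and self_mem_nhdsWithin)).exists
  exact ⟨y, ⟨EReal.coe_lt_coe_iff.2 hy3, hy2⟩, hy1⟩

theorem exists_eval_pos_of_right_pos {p : ℝ[X]} {a : EReal} {b : ℝ} (hab : a < b)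
    (hb : 0 < p.eval b) : ∃ y ∈ slice a b, 0 < p.eval y := by
  have h1 : ∀ᶠ y in 𝓝[<] b, 0 < p.eval y :=
    (p.continuous.continuousAt.eventually_const_lt hb).filter_mono nhdsWithin_le_nhds
  have h2 : ∀ᶠ y : ℝ in 𝓝[<] b, a < (y : EReal) :=
    (continuous_coe_real_ereal.continuousAt.eventually_const_lt hab).filter_mono
      nhdsWithin_le_nhds
  obtain ⟨y, hy1, hy2, hy3⟩ := (h1.and (h2.and self_mem_nhdsWithin)).exists
  exact ⟨y, ⟨hy2, EReal.coe_lt_coe_iff.2 hy3⟩, hy1⟩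

theorem exists_eval_neg_of_bot {p : ℝ[X]} {b : EReal} (hb : ⊥ < b) (hp : 0 < p.degree)
    (h : ∀ y ∈ slice ⊥ b, 0 < p.derivative.eval y) : ∃ y ∈ slice ⊥ b, p.eval y < 0 := by
  obtain ⟨y₀, hy₀⟩ := slice_nonempty hb
  have ht := p.tendsto_norm_atTop hp (z := fun y : ℝ => y) tendsto_abs_atBot_atTop
  obtain ⟨y, hy, hlt⟩ := ((ht.eventually_gt_atTop ‖p.eval y₀‖).and (eventually_lt_atBot y₀)).exists
  have hmem : y ∈ slice ⊥ b :=
    ⟨EReal.bot_lt_coe y, (EReal.coe_lt_coe_iff.2 hlt).trans hy₀.2⟩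
  have hmono : p.eval y < p.eval y₀ := strictMonoOn_slice h hmem hy₀ hlt
  refine ⟨y, hmem, ?_⟩
  by_contra! hn
  rw [Real.norm_eq_abs, Real.norm_eq_abs, abs_of_nonneg hn] at hy
  exact absurd (hmono.trans_le (le_abs_self _)) hy.not_gt

theorem exists_eval_pos_of_top {p : ℝ[X]} {a : EReal} (ha : a < ⊤) (hp : 0 < p.degree)
    (h : ∀ y ∈ slice a ⊤, 0 < p.derivative.eval y) : ∃ y ∈ slice a ⊤, 0 < p.eval y := by
  obtain ⟨y₀, hy₀⟩ := slice_nonempty ha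
  have ht := p.tendsto_norm_atTop hp (z := fun y : ℝ => y) tendsto_abs_atTop_atTop
  obtain ⟨y, hy, hlt⟩ := ((ht.eventually_gt_atTop ‖p.eval y₀‖).and (eventually_gt_atTop y₀)).exists
  have hmem : y ∈ slice a ⊤ :=
    ⟨hy₀.1.trans (EReal.coe_lt_coe_iff.2 hlt), EReal.coe_lt_top y⟩
  have hmono : p.eval y₀ < p.eval y := strictMonoOn_slice h hy₀ hmem hlt
  refine ⟨y, hmem, ?_⟩
  by_contra! hn
  rw [Real.norm_eq_abs, Real.norm_eq_abs, abs_of_nonpos hn] at hy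
  have := neg_abs_le (p.eval y₀)
  linarith

/-- A continuous function that is strictly increasing and changes sign along each fibre of an
open band over `B` vanishes exactly on the graph of a continuous function. -/
theorem exists_continuousOn_root {X : Type*} [TopologicalSpace X] {B : Set X}
    {lo hi : X → EReal} (hlo : ContinuousOn lo B) (hhi : ContinuousOn hi B) {g : X × ℝ → ℝ}
    (hg : Continuous g) (hmono : ∀ x ∈ B, StrictMonoOn (fun y => g (x, y)) (slice (lo x) (hi x)))
    (hneg : ∀ x ∈ B, ∃ y ∈ slice (lo x) (hi x), g (x, y) < 0)
    (hpos : ∀ x ∈ B, ∃ y ∈ slice (lo x) (hi x), 0 < g (x, y)) :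
    ∃ η : X → ℝ, ContinuousOn η B ∧ ∀ x ∈ B, η x ∈ slice (lo x) (hi x) ∧ g (x, η x) = 0 := by
  have hex : ∀ x, ∃ y, x ∈ B → y ∈ slice (lo x) (hi x) ∧ g (x, y) = 0 := by
    intro x
    by_cases hx : x ∈ B
    · obtain ⟨y₁, h₁, hn⟩ := hneg x hx
      obtain ⟨y₂, h₂, hp⟩ := hpos x hx
      have hlt : y₁ < y₂ := (hmono x hx).lt_iff_lt h₁ h₂ |>.1 (hn.trans hp)
      obtain ⟨y, hy, h0⟩ := intermediate_value_Icc hlt.le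
        (f := fun y => g (x, y)) (by fun_prop) ⟨hn.le, hp.le⟩
      exact ⟨y, fun _ => ⟨(ordConnected_slice _ _).out h₁ h₂ hy, h0⟩⟩
    · exact ⟨0, fun h => absurd h hx⟩
  choose η hη using hex
  refine ⟨η, ?_, hη⟩
  intro x₀ hx₀
  obtain ⟨hmem, h0⟩ := hη x₀ hx₀
  have key : ∀ y ∈ slice (lo x₀) (hi x₀), ∀ᶠ x in 𝓝[B] x₀, x ∈ B ∧ y ∈ slice (lo x) (hi x) := by
    intro y hy
    filter_upwards [self_mem_nhdsWithin, (hlo x₀ hx₀).eventually_lt_const hy.1,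
      (hhi x₀ hx₀).eventually_const_lt hy.2] with x h1 h2 h3
    exact ⟨h1, h2, h3⟩
  have hgc : ∀ y, ContinuousWithinAt (fun x => g (x, y)) B x₀ := fun y =>
    (by fun_prop : Continuous fun x => g (x, y)).continuousWithinAt
  refine tendsto_order.2 ⟨fun a ha => ?_, fun b hb => ?_⟩
  · obtain ⟨y, hy1, hy2⟩ := EReal.lt_iff_exists_real_btwn.1
      (max_lt (EReal.coe_lt_coe_iff.2 ha) hmem.1)
    have hys : y ∈ slice (lo x₀) (hi x₀) :=
      ⟨(le_max_right _ _).trans_lt hy1, hy2.trans hmem.2⟩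
    have hgy : g (x₀, y) < 0 := by
      rw [← h0]; exact hmono x₀ hx₀ hys hmem (EReal.coe_lt_coe_iff.1 hy2)
    filter_upwards [key y hys, (hgc y).eventually_lt_const hgy] with x ⟨hx, hyx⟩ hgx
    rw [← (hη x hx).2] at hgx
    exact (EReal.coe_lt_coe_iff.1 ((le_max_left _ _).trans_lt hy1)).trans
      ((hmono x hx).lt_iff_lt hyx (hη x hx).1 |>.1 hgx)
  · obtain ⟨y, hy1, hy2⟩ := EReal.lt_iff_exists_real_btwn.1
      (lt_min (EReal.coe_lt_coe_iff.2 hb) hmem.2)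
    have hys : y ∈ slice (lo x₀) (hi x₀) :=
      ⟨hmem.1.trans hy1, hy2.trans_le (min_le_right _ _)⟩
    have hgy : 0 < g (x₀, y) := by
      rw [← h0]; exact hmono x₀ hx₀ hmem hys (EReal.coe_lt_coe_iff.1 hy1)
    filter_upwards [key y hys, (hgc y).eventually_const_lt hgy] with x ⟨hx, hyx⟩ hgx
    rw [← (hη x hx).2] at hgx
    exact ((hmono x hx).lt_iff_lt (hη x hx).1 hyx |>.1 hgx).trans
      (EReal.coe_lt_coe_iff.1 (hy2.trans_le (min_le_left _ _)))

end Interval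

section Semialgebraic

theorem IsSemialgebraic.inter {n : ℕ} {s t : Set (Fin n → ℝ)} (hs : IsSemialgebraic s)
    (ht : IsSemialgebraic t) : IsSemialgebraic (s ∩ t) := by
  have := (hs.compl.union ht.compl).compl
  rwa [← Set.compl_inter, compl_compl] at this

theorem IsSemialgebraic.univ {n : ℕ} : IsSemialgebraic (Set.univ : Set (Fin n → ℝ)) := by
  simpa using IsSemialgebraic.zero_set (0 : MvPolynomial (Fin n) ℝ)

theorem IsSemialgebraic.empty {n : ℕ} : IsSemialgebraic (∅ : Set (Fin n → ℝ)) := by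
  simpa using (IsSemialgebraic.univ (n := n)).compl

theorem IsSemialgebraic.biUnion {n : ℕ} {ι : Type*} {I : Set ι} (hI : I.Finite)
    {s : ι → Set (Fin n → ℝ)} (h : ∀ i ∈ I, IsSemialgebraic (s i)) :
    IsSemialgebraic (⋃ i ∈ I, s i) := by
  induction I, hI using Set.Finite.induction_on with
  | empty => simpa using IsSemialgebraic.empty
  | insert _ _ ih =>
    rw [Set.biUnion_insert]
    exact (h _ (Set.mem_insert _ _)).union (ih fun i hi => h i (Set.mem_insert_of_mem _ hi))

theorem IsSemialgebraic.biInter {n : ℕ} {ι : Type*} {I : Set ι} (hI : I.Finite)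
    {s : ι → Set (Fin n → ℝ)} (h : ∀ i ∈ I, IsSemialgebraic (s i)) :
    IsSemialgebraic (⋂ i ∈ I, s i) := by
  induction I, hI using Set.Finite.induction_on with
  | empty => simpa using IsSemialgebraic.univ
  | insert _ _ ih =>
    rw [Set.biInter_insert]
    exact (h _ (Set.mem_insert _ _)).inter (ih fun i hi => h i (Set.mem_insert_of_mem _ hi))

theorem isSemialgebraic_sign_eq {n : ℕ} (p : MvPolynomial (Fin n) ℝ) (σ : SignType) :
    IsSemialgebraic {x | SignType.sign (MvPolynomial.eval x p) = σ} := by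
  cases σ with
  | zero => simpa [sign_eq_zero_iff] using IsSemialgebraic.zero_set p
  | pos => simpa [sign_eq_one_iff] using IsSemialgebraic.pos_set p
  | neg => simpa [sign_eq_neg_one_iff] using IsSemialgebraic.pos_set (-p)

theorem IsSemialgebraic.preimage_init {n : ℕ} {B : Set (Fin n → ℝ)} (hB : IsSemialgebraic B) :
    IsSemialgebraic {w : Fin (n + 1) → ℝ | Fin.init w ∈ B} := by
  have key : ∀ (w : Fin (n + 1) → ℝ) (p : MvPolynomial (Fin n) ℝ),
      MvPolynomial.eval w (MvPolynomial.rename Fin.castSucc p)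
        = MvPolynomial.eval (Fin.init w) p := fun w p => by
    rw [MvPolynomial.eval_rename]; rfl
  induction hB with
  | zero_set p =>
    have := IsSemialgebraic.zero_set (MvPolynomial.rename Fin.castSucc p)
    simp only [key] at this
    exact this
  | pos_set p =>
    have := IsSemialgebraic.pos_set (MvPolynomial.rename Fin.castSucc p)
    simp only [key] at this
    exact this
  | union _ _ h₁ h₂ => exact h₁.union h₂
  | compl _ h => exact h.compl

end Semialgebraic

section FiberEval

open Polynomial

/-- The value at `z = (x, y)` of a polynomial in one variable over the ring of polynomial
functions of `x`. -/
noncomputable def fiberEval {n : ℕ} (p : (MvPolynomial (Fin n) ℝ)[X]) (z : (Fin n → ℝ) × ℝ) : ℝ :=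
  (p.map (MvPolynomial.eval z.1)).eval z.2

theorem continuous_fiberEval {n : ℕ} (p : (MvPolynomial (Fin n) ℝ)[X]) :
    Continuous (fiberEval p) := by
  have : fiberEval p = fun z => ∑ i ∈ Finset.range (p.natDegree + 1),
      MvPolynomial.eval z.1 (p.coeff i) * z.2 ^ i := by
    funext z
    rw [fiberEval, eval_map, eval₂_eq_sum_range]
  rw [this]
  refine continuous_finsetSum _ fun i _ => ?_
  exact ((MvPolynomial.continuous_eval (p.coeff i)).comp continuous_fst).mul
    (continuous_snd.pow i)

/-- A subset of `ℝⁿ × ℝ` that is semialgebraic as a subset of `ℝⁿ⁺¹`. -/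
def IsSemialgebraicProd {n : ℕ} (S : Set ((Fin n → ℝ) × ℝ)) : Prop :=
  IsSemialgebraic {w : Fin (n + 1) → ℝ | (Fin.init w, w (Fin.last n)) ∈ S}

theorem IsSemialgebraicProd.union {n : ℕ} {S T : Set ((Fin n → ℝ) × ℝ)}
    (hS : IsSemialgebraicProd S) (hT : IsSemialgebraicProd T) : IsSemialgebraicProd (S ∪ T) :=
  IsSemialgebraic.union hS hT

theorem IsSemialgebraicProd.inter {n : ℕ} {S T : Set ((Fin n → ℝ) × ℝ)}
    (hS : IsSemialgebraicProd S) (hT : IsSemialgebraicProd T) : IsSemialgebraicProd (S ∩ T) :=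
  IsSemialgebraic.inter hS hT

theorem IsSemialgebraicProd.diff {n : ℕ} {S T : Set ((Fin n → ℝ) × ℝ)}
    (hS : IsSemialgebraicProd S) (hT : IsSemialgebraicProd T) : IsSemialgebraicProd (S \ T) :=
  IsSemialgebraic.inter hS (IsSemialgebraic.compl hT)

theorem IsSemialgebraic.cylinder {n : ℕ} {B : Set (Fin n → ℝ)} (hB : IsSemialgebraic B) :
    IsSemialgebraicProd {z : (Fin n → ℝ) × ℝ | z.1 ∈ B} :=
  hB.preimage_init

theorem exists_eval_eq_fiberEval {n : ℕ} (p : (MvPolynomial (Fin n) ℝ)[X]) :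
    ∃ P : MvPolynomial (Fin (n + 1)) ℝ, ∀ w : Fin (n + 1) → ℝ,
      MvPolynomial.eval w P = fiberEval p (Fin.init w, w (Fin.last n)) := by
  refine ⟨p.eval₂ (MvPolynomial.rename Fin.castSucc).toRingHom (MvPolynomial.X (Fin.last n)),
    fun w => ?_⟩
  rw [hom_eval₂, fiberEval, eval_map, MvPolynomial.eval_X]
  congr 1
  ext x
  · simp
  · simp [Fin.init]

theorem exists_fiberEval_eq_eval {n : ℕ} (P : MvPolynomial (Fin (n + 1)) ℝ) :
    ∃ p : (MvPolynomial (Fin n) ℝ)[X], ∀ z : (Fin n → ℝ) × ℝ,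
      fiberEval p z = MvPolynomial.eval (Fin.snoc z.1 z.2 : Fin (n + 1) → ℝ) P := by
  refine ⟨MvPolynomial.eval₂ (C.comp MvPolynomial.C)
    (Fin.snoc (α := fun _ => (MvPolynomial (Fin n) ℝ)[X]) (fun i => C (MvPolynomial.X i)) X) P,
    fun z => ?_⟩
  rw [fiberEval]
  induction P using MvPolynomial.induction_on with
  | C a => simp
  | add p q hp hq => simp [hp, hq]
  | mul_X p i hp =>
    rw [MvPolynomial.eval₂_mul, Polynomial.map_mul, eval_mul, hp, map_mul,
      MvPolynomial.eval₂_X, MvPolynomial.eval_X]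
    congr 1
    refine Fin.lastCases ?_ (fun j => ?_) i <;> simp

theorem isSemialgebraicProd_sign_eq {n : ℕ} (p : (MvPolynomial (Fin n) ℝ)[X]) (σ : SignType) :
    IsSemialgebraicProd {z | SignType.sign (fiberEval p z) = σ} := by
  obtain ⟨P, hP⟩ := exists_eval_eq_fiberEval p
  have := isSemialgebraic_sign_eq P σ
  simp only [hP] at this
  exact this

end FiberEval

section Cells

open Polynomial

/-- Every member of `G` has constant sign on `S`. -/
def SignConstOn {n : ℕ} (G : Set (MvPolynomial (Fin n) ℝ)[X]) (S : Set ((Fin n → ℝ) × ℝ)) : Prop :=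
  ∀ g ∈ G, ∃ σ : SignType, ∀ z ∈ S, SignType.sign (fiberEval g z) = σ

theorem SignConstOn.mono {n : ℕ} {G : Set (MvPolynomial (Fin n) ℝ)[X]}
    {S T : Set ((Fin n → ℝ) × ℝ)} (h : SignConstOn G T) (hST : S ⊆ T) : SignConstOn G S :=
  fun g hg => let ⟨σ, hσ⟩ := h g hg; ⟨σ, fun z hz => hσ z (hST hz)⟩

theorem SignConstOn.insert {n : ℕ} {G : Set (MvPolynomial (Fin n) ℝ)[X]}
    {S : Set ((Fin n → ℝ) × ℝ)} (h : SignConstOn G S) {p : (MvPolynomial (Fin n) ℝ)[X]}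
    {σ : SignType} (hp : ∀ z ∈ S, SignType.sign (fiberEval p z) = σ) :
    SignConstOn (insert p G) S := by
  rintro g (rfl | hg)
  · exact ⟨σ, hp⟩
  · exact h g hg

/-- The graph of `ξ` over `B`. -/
def sectionSet {n : ℕ} (B : Set (Fin n → ℝ)) (ξ : (Fin n → ℝ) → ℝ) : Set ((Fin n → ℝ) × ℝ) :=
  {z | z.1 ∈ B ∧ z.2 = ξ z.1}

/-- The open band over `B` between `lo` and `hi`. -/
def bandSet {n : ℕ} (B : Set (Fin n → ℝ)) (lo hi : (Fin n → ℝ) → EReal) :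
    Set ((Fin n → ℝ) × ℝ) :=
  {z | z.1 ∈ B ∧ z.2 ∈ slice (lo z.1) (hi z.1)}

/-- A continuous semialgebraic function over `B` which is a root of a member of `G` and along
whose graph all members of `G` have constant sign. -/
structure IsRootSection {n : ℕ} (B : Set (Fin n → ℝ)) (G : Set (MvPolynomial (Fin n) ℝ)[X])
    (ξ : (Fin n → ℝ) → ℝ) : Prop where
  continuousOn : ContinuousOn ξ B
  lt_sa : IsSemialgebraicProd {z : (Fin n → ℝ) × ℝ | z.1 ∈ B ∧ z.2 < ξ z.1}
  gt_sa : IsSemialgebraicProd {z : (Fin n → ℝ) × ℝ | z.1 ∈ B ∧ ξ z.1 < z.2}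
  root : ∃ q ∈ G, 0 < q.natDegree ∧
    ∀ x ∈ B, MvPolynomial.eval x q.leadingCoeff ≠ 0 ∧ fiberEval q (x, ξ x) = 0
  sign : SignConstOn G (sectionSet B ξ)

/-- `lo` is `-∞` or a root section. -/
def IsLowerEnd {n : ℕ} (B : Set (Fin n → ℝ)) (G : Set (MvPolynomial (Fin n) ℝ)[X])
    (lo : (Fin n → ℝ) → EReal) : Prop :=
  (lo = fun _ => ⊥) ∨ ∃ ξ, IsRootSection B G ξ ∧ lo = fun x => (ξ x : EReal)

/-- `hi` is `+∞` or a root section. -/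
def IsUpperEnd {n : ℕ} (B : Set (Fin n → ℝ)) (G : Set (MvPolynomial (Fin n) ℝ)[X])
    (hi : (Fin n → ℝ) → EReal) : Prop :=
  (hi = fun _ => ⊤) ∨ ∃ ξ, IsRootSection B G ξ ∧ hi = fun x => (ξ x : EReal)

/-- The bounds `lo < hi` define an open band on which all members of `G` have constant sign. -/
structure IsBand {n : ℕ} (B : Set (Fin n → ℝ)) (G : Set (MvPolynomial (Fin n) ℝ)[X])
    (lo hi : (Fin n → ℝ) → EReal) : Prop where
  lower : IsLowerEnd B G lo
  upper : IsUpperEnd B G hi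
  lt : ∀ x ∈ B, lo x < hi x
  sign : SignConstOn G (bandSet B lo hi)

/-- A cell over `B`: the graph of a root section or a band between two of them. -/
def IsCell {n : ℕ} (B : Set (Fin n → ℝ)) (G : Set (MvPolynomial (Fin n) ℝ)[X])
    (S : Set ((Fin n → ℝ) × ℝ)) : Prop :=
  (∃ ξ, IsRootSection B G ξ ∧ S = sectionSet B ξ) ∨
    ∃ lo hi, IsBand B G lo hi ∧ S = bandSet B lo hi

theorem IsCell.signConstOn {n : ℕ} {B : Set (Fin n → ℝ)} {G : Set (MvPolynomial (Fin n) ℝ)[X]}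
    {S : Set ((Fin n → ℝ) × ℝ)} (h : IsCell B G S) : SignConstOn G S := by
  rcases h with ⟨ξ, hξ, rfl⟩ | ⟨lo, hi, hb, rfl⟩
  · exact hξ.sign
  · exact hb.sign

theorem IsRootSection.isSemialgebraicProd {n : ℕ} {B : Set (Fin n → ℝ)}
    {G : Set (MvPolynomial (Fin n) ℝ)[X]} {ξ : (Fin n → ℝ) → ℝ} (h : IsRootSection B G ξ)
    (hB : IsSemialgebraic B) : IsSemialgebraicProd (sectionSet B ξ) := by
  convert (hB.cylinder.diff h.lt_sa).diff h.gt_sa using 1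
  ext z
  simp only [sectionSet, Set.mem_ofPred_eq, Set.mem_sdiff, not_and, not_lt]
  exact ⟨fun ⟨h1, h2⟩ => ⟨⟨h1, fun _ => h2.ge⟩, fun _ => h2.le⟩,
    fun ⟨⟨h1, h2⟩, h3⟩ => ⟨h1, le_antisymm (h3 h1) (h2 h1)⟩⟩

theorem IsLowerEnd.isSemialgebraicProd {n : ℕ} {B : Set (Fin n → ℝ)}
    {G : Set (MvPolynomial (Fin n) ℝ)[X]} {lo : (Fin n → ℝ) → EReal} (h : IsLowerEnd B G lo)
    (hB : IsSemialgebraic B) :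
    IsSemialgebraicProd {z : (Fin n → ℝ) × ℝ | z.1 ∈ B ∧ lo z.1 < z.2} := by
  rcases h with rfl | ⟨ξ, hξ, rfl⟩
  · simpa [EReal.bot_lt_coe] using hB.cylinder
  · simpa [EReal.coe_lt_coe_iff] using hξ.gt_sa

theorem IsUpperEnd.isSemialgebraicProd {n : ℕ} {B : Set (Fin n → ℝ)}
    {G : Set (MvPolynomial (Fin n) ℝ)[X]} {hi : (Fin n → ℝ) → EReal} (h : IsUpperEnd B G hi)
    (hB : IsSemialgebraic B) :
    IsSemialgebraicProd {z : (Fin n → ℝ) × ℝ | z.1 ∈ B ∧ z.2 < hi z.1} := by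
  rcases h with rfl | ⟨ξ, hξ, rfl⟩
  · simpa [EReal.coe_lt_top] using hB.cylinder
  · simpa [EReal.coe_lt_coe_iff] using hξ.lt_sa

theorem IsBand.isSemialgebraicProd {n : ℕ} {B : Set (Fin n → ℝ)}
    {G : Set (MvPolynomial (Fin n) ℝ)[X]} {lo hi : (Fin n → ℝ) → EReal} (h : IsBand B G lo hi)
    (hB : IsSemialgebraic B) : IsSemialgebraicProd (bandSet B lo hi) := by
  convert (h.lower.isSemialgebraicProd hB).inter (h.upper.isSemialgebraicProd hB) using 1
  ext z
  simp only [bandSet, slice, Set.mem_ofPred_eq, Set.mem_inter_iff]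
  tauto

theorem IsLowerEnd.continuousOn {n : ℕ} {B : Set (Fin n → ℝ)}
    {G : Set (MvPolynomial (Fin n) ℝ)[X]} {lo : (Fin n → ℝ) → EReal} (h : IsLowerEnd B G lo) :
    ContinuousOn lo B := by
  rcases h with rfl | ⟨ξ, hξ, rfl⟩
  · exact continuousOn_const
  · exact continuous_coe_real_ereal.comp_continuousOn hξ.continuousOn

theorem IsUpperEnd.continuousOn {n : ℕ} {B : Set (Fin n → ℝ)}
    {G : Set (MvPolynomial (Fin n) ℝ)[X]} {hi : (Fin n → ℝ) → EReal} (h : IsUpperEnd B G hi) :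
    ContinuousOn hi B := by
  rcases h with rfl | ⟨ξ, hξ, rfl⟩
  · exact continuousOn_const
  · exact continuous_coe_real_ereal.comp_continuousOn hξ.continuousOn

theorem isPreconnected_sectionSet {n : ℕ} {B : Set (Fin n → ℝ)} {ξ : (Fin n → ℝ) → ℝ}
    (hB : IsPreconnected B) (hξ : ContinuousOn ξ B) : IsPreconnected (sectionSet B ξ) := by
  have : sectionSet B ξ = (fun x => (x, ξ x)) '' B := by
    ext ⟨x, y⟩
    simp only [sectionSet, Set.mem_ofPred_eq, Set.mem_image, Prod.mk.injEq]
    exact ⟨fun ⟨h1, h2⟩ => ⟨x, h1, rfl, h2.symm⟩, by rintro ⟨_, h, rfl, rfl⟩; exact ⟨h, rfl⟩⟩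
  rw [this]
  exact hB.image _ (continuousOn_id.prodMk hξ)

theorem IsBand.exists_continuousOn_mem_slice {n : ℕ} {B : Set (Fin n → ℝ)}
    {G : Set (MvPolynomial (Fin n) ℝ)[X]} {lo hi : (Fin n → ℝ) → EReal} (h : IsBand B G lo hi) :
    ∃ m : (Fin n → ℝ) → ℝ, ContinuousOn m B ∧ ∀ x ∈ B, m x ∈ slice (lo x) (hi x) := by
  have hlt := h.lt
  rcases h.lower with rfl | ⟨ξ, hξ, rfl⟩ <;> rcases h.upper with rfl | ⟨ζ, hζ, rfl⟩
  · exact ⟨fun _ => 0, continuousOn_const, fun x _ => ⟨EReal.bot_lt_coe _, EReal.coe_lt_top _⟩⟩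
  · exact ⟨fun x => ζ x - 1, hζ.continuousOn.sub continuousOn_const,
      fun x _ => ⟨EReal.bot_lt_coe _, EReal.coe_lt_coe_iff.2 (by linarith)⟩⟩
  · exact ⟨fun x => ξ x + 1, hξ.continuousOn.add continuousOn_const,
      fun x _ => ⟨EReal.coe_lt_coe_iff.2 (by linarith), EReal.coe_lt_top _⟩⟩
  · refine ⟨fun x => (ξ x + ζ x) / 2, (hξ.continuousOn.add hζ.continuousOn).div_const 2,
      fun x hx => ?_⟩
    have := EReal.coe_lt_coe_iff.1 (hlt x hx)
    exact ⟨EReal.coe_lt_coe_iff.2 (by linarith), EReal.coe_lt_coe_iff.2 (by linarith)⟩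

theorem IsBand.isPreconnected {n : ℕ} {B : Set (Fin n → ℝ)}
    {G : Set (MvPolynomial (Fin n) ℝ)[X]} {lo hi : (Fin n → ℝ) → EReal} (h : IsBand B G lo hi)
    (hB : IsPreconnected B) : IsPreconnected (bandSet B lo hi) := by
  obtain ⟨m, hm, hmem⟩ := h.exists_continuousOn_mem_slice
  have hsec := isPreconnected_sectionSet hB hm
  have hsub : sectionSet B m ⊆ bandSet B lo hi := by
    rintro ⟨x, y⟩ ⟨hx, hy⟩
    exact ⟨hx, (show y = m x from hy) ▸ hmem x hx⟩
  refine isPreconnected_of_forall_pair ?_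
  rintro ⟨x, y⟩ hz ⟨x', y'⟩ hz'
  have hfib : ∀ x ∈ B, IsPreconnected ({x} ×ˢ slice (lo x) (hi x) : Set ((Fin n → ℝ) × ℝ)) :=
    fun x _ => isPreconnected_singleton.prod (ordConnected_slice _ _).isPreconnected
  have hfsub : ∀ x ∈ B,
      ({x} ×ˢ slice (lo x) (hi x) : Set ((Fin n → ℝ) × ℝ)) ⊆ bandSet B lo hi := by
    rintro x hx ⟨x₁, y₁⟩ ⟨h1, h2⟩
    obtain rfl : x₁ = x := h1
    exact ⟨hx, h2⟩
  have hu : ∀ x ∈ B, IsPreconnected (sectionSet B m ∪ {x} ×ˢ slice (lo x) (hi x)) := fun x hx =>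
    hsec.union (x, m x) ⟨hx, rfl⟩ ⟨rfl, hmem x hx⟩ (hfib x hx)
  refine ⟨(sectionSet B m ∪ {x} ×ˢ slice (lo x) (hi x)) ∪
    (sectionSet B m ∪ {x'} ×ˢ slice (lo x') (hi x')), ?_, Or.inl (Or.inr ⟨rfl, hz.2⟩),
    Or.inr (Or.inr ⟨rfl, hz'.2⟩), (hu x hz.1).union (x, m x) (Or.inl ⟨hz.1, rfl⟩)
      (Or.inl ⟨hz.1, rfl⟩) (hu x' hz'.1)⟩
  exact Set.union_subset (Set.union_subset hsub (hfsub x hz.1))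
    (Set.union_subset hsub (hfsub x' hz'.1))

theorem IsCell.isSemialgebraicProd {n : ℕ} {B : Set (Fin n → ℝ)}
    {G : Set (MvPolynomial (Fin n) ℝ)[X]} {S : Set ((Fin n → ℝ) × ℝ)} (h : IsCell B G S)
    (hB : IsSemialgebraic B) : IsSemialgebraicProd S := by
  rcases h with ⟨ξ, hξ, rfl⟩ | ⟨lo, hi, hb, rfl⟩
  · exact hξ.isSemialgebraicProd hB
  · exact hb.isSemialgebraicProd hB

theorem IsCell.isPreconnected {n : ℕ} {B : Set (Fin n → ℝ)}
    {G : Set (MvPolynomial (Fin n) ℝ)[X]} {S : Set ((Fin n → ℝ) × ℝ)} (h : IsCell B G S)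
    (hB : IsPreconnected B) : IsPreconnected S := by
  rcases h with ⟨ξ, hξ, rfl⟩ | ⟨lo, hi, hb, rfl⟩
  · exact isPreconnected_sectionSet hB hξ.continuousOn
  · exact hb.isPreconnected hB

end Cells

section Splitting

open Polynomial

theorem fiberEval_neg {n : ℕ} (p : (MvPolynomial (Fin n) ℝ)[X]) (z : (Fin n → ℝ) × ℝ) :
    fiberEval (-p) z = -fiberEval p z := by
  simp [fiberEval]

theorem fiberEval_eraseLead {n : ℕ} {p : (MvPolynomial (Fin n) ℝ)[X]} {z : (Fin n → ℝ) × ℝ}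
    (h : MvPolynomial.eval z.1 p.leadingCoeff = 0) :
    fiberEval p.eraseLead z = fiberEval p z := by
  have hp := congrArg (fun r => fiberEval r z) p.eraseLead_add_C_mul_X_pow
  simpa [fiberEval, -eraseLead_add_C_mul_X_pow, h] using hp

theorem fiberEval_of_natDegree_eq_zero {n : ℕ} {p : (MvPolynomial (Fin n) ℝ)[X]}
    (h : p.natDegree = 0) (z : (Fin n → ℝ) × ℝ) :
    fiberEval p z = MvPolynomial.eval z.1 p.leadingCoeff := by
  obtain ⟨c, rfl⟩ := natDegree_eq_zero.1 h
  simp [fiberEval]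

theorem degree_map_eval_pos {n : ℕ} {p : (MvPolynomial (Fin n) ℝ)[X]} (hp : 0 < p.natDegree)
    {x : Fin n → ℝ} (h : MvPolynomial.eval x p.leadingCoeff ≠ 0) :
    0 < (p.map (MvPolynomial.eval x)).degree := by
  rw [← natDegree_pos_iff_degree_pos, natDegree_map_of_leadingCoeff_ne_zero _ h]
  exact hp

theorem IsRootSection.insert {n : ℕ} {B : Set (Fin n → ℝ)}
    {G : Set (MvPolynomial (Fin n) ℝ)[X]} {ξ : (Fin n → ℝ) → ℝ} (h : IsRootSection B G ξ)
    {p : (MvPolynomial (Fin n) ℝ)[X]} (hrem : ∀ q ∈ G, 0 < q.natDegree → pseudoRem p q ∈ G)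
    (hlc : ∀ q ∈ G, ∃ σ : SignType, ∀ x ∈ B,
      SignType.sign (MvPolynomial.eval x q.leadingCoeff) = σ) :
    IsRootSection B (insert p G) ξ := by
  obtain ⟨q, hqG, hq0, hq⟩ := h.root
  refine ⟨h.continuousOn, h.lt_sa, h.gt_sa, ⟨q, Set.mem_insert_of_mem _ hqG, hq0, hq⟩, ?_⟩
  obtain ⟨k, a, hka⟩ := pseudoRem_spec p hq0
  obtain ⟨σ, hσ⟩ := hlc q hqG
  obtain ⟨τ, hτ⟩ := h.sign _ (hrem q hqG hq0)
  refine h.sign.insert (σ := σ ^ k * τ) ?_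
  rintro ⟨x, y⟩ ⟨hx, hy⟩
  obtain rfl : y = ξ x := hy
  have hmul : MvPolynomial.eval x q.leadingCoeff ^ k * fiberEval p (x, ξ x)
      = fiberEval (pseudoRem p q) (x, ξ x) := by
    have h1 := congrArg (fun r => fiberEval r (x, ξ x)) hka
    have h2 := (hq x hx).2
    simp only [fiberEval, Polynomial.map_mul, Polynomial.map_pow, Polynomial.map_add, map_C,
      eval_mul, eval_pow, eval_add, eval_C] at h1 h2 ⊢
    rw [h1, h2, zero_mul, zero_add]
  have hs := congrArg SignType.sign hmul
  rw [sign_mul, sign_pow, hσ x hx, hτ (x, ξ x) ⟨hx, rfl⟩] at hs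
  have hσ0 : σ ≠ 0 := by
    rw [← hσ x hx]
    exact sign_ne_zero.2 (hq x hx).1
  have hσσ : σ ^ k * σ ^ k = 1 := by
    rw [← mul_pow]
    have : σ * σ = 1 := by revert hσ0; cases σ <;> decide
    rw [this, one_pow]
  rw [← hs, ← mul_assoc, hσσ, one_mul]

/-- Along a band where `p` is fibrewise increasing, with constant signs at the finite ends,
either `p` has constant sign or it changes sign along the graph of a continuous function. -/
theorem sign_const_or_exists_root_of_derivative_pos {n : ℕ} {B : Set (Fin n → ℝ)}
    {lo hi : (Fin n → ℝ) → EReal} {p : (MvPolynomial (Fin n) ℝ)[X]}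
    (hloc : ContinuousOn lo B) (hhic : ContinuousOn hi B) (hlt : ∀ x ∈ B, lo x < hi x)
    (hlo : (lo = fun _ => ⊥) ∨ ∃ ξ : (Fin n → ℝ) → ℝ, (lo = fun x => (ξ x : EReal)) ∧
      ∃ σ : SignType, ∀ x ∈ B, SignType.sign (fiberEval p (x, ξ x)) = σ)
    (hhi : (hi = fun _ => ⊤) ∨ ∃ ξ : (Fin n → ℝ) → ℝ, (hi = fun x => (ξ x : EReal)) ∧
      ∃ σ : SignType, ∀ x ∈ B, SignType.sign (fiberEval p (x, ξ x)) = σ)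
    (hdeg : 0 < p.natDegree) (hlc : ∀ x ∈ B, MvPolynomial.eval x p.leadingCoeff ≠ 0)
    (hder : ∀ z ∈ bandSet B lo hi, 0 < fiberEval (derivative p) z) :
    (∃ σ : SignType, ∀ z ∈ bandSet B lo hi, SignType.sign (fiberEval p z) = σ) ∨
      ∃ η : (Fin n → ℝ) → ℝ, ContinuousOn η B ∧ ∀ x ∈ B, η x ∈ slice (lo x) (hi x) ∧
        ∀ y ∈ slice (lo x) (hi x),
          SignType.sign (fiberEval p (x, y)) = SignType.sign (y - η x) := by
  have hder' : ∀ x ∈ B, ∀ y ∈ slice (lo x) (hi x),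
      0 < (derivative (p.map (MvPolynomial.eval x))).eval y := fun x hx y hy => by
    rw [derivative_map]
    exact hder (x, y) ⟨hx, hy⟩
  have hmono : ∀ x ∈ B, StrictMonoOn (fun y => fiberEval p (x, y)) (slice (lo x) (hi x)) :=
    fun x hx => strictMonoOn_slice (hder' x hx)
  have hneg : (∀ x ∈ B, ∃ y ∈ slice (lo x) (hi x), fiberEval p (x, y) < 0) ∨
      ∀ z ∈ bandSet B lo hi, SignType.sign (fiberEval p z) = 1 := by
    rcases hlo with rfl | ⟨ξ, rfl, σ, hσ⟩
    · exact Or.inl fun x hx => exists_eval_neg_of_bot (hlt x hx)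
        (degree_map_eval_pos hdeg (hlc x hx)) (hder' x hx)
    · by_cases h : σ = -1
      · exact Or.inl fun x hx => exists_eval_neg_of_left_neg (hlt x hx)
          (sign_eq_neg_one_iff.1 ((hσ x hx).trans h))
      · refine Or.inr fun z hz => sign_eq_one_iff.2 ?_
        have h0 : 0 ≤ fiberEval p (z.1, ξ z.1) := by
          by_contra! hn
          exact h ((hσ z.1 hz.1).symm.trans (sign_eq_neg_one_iff.2 hn))
        exact h0.trans_lt (eval_left_lt_of_derivative_pos (hder' z.1 hz.1) hz.2)
  have hpos : (∀ x ∈ B, ∃ y ∈ slice (lo x) (hi x), 0 < fiberEval p (x, y)) ∨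
      ∀ z ∈ bandSet B lo hi, SignType.sign (fiberEval p z) = -1 := by
    rcases hhi with rfl | ⟨ξ, rfl, σ, hσ⟩
    · exact Or.inl fun x hx => exists_eval_pos_of_top (hlt x hx)
        (degree_map_eval_pos hdeg (hlc x hx)) (hder' x hx)
    · by_cases h : σ = 1
      · exact Or.inl fun x hx => exists_eval_pos_of_right_pos (hlt x hx)
          (sign_eq_one_iff.1 ((hσ x hx).trans h))
      · refine Or.inr fun z hz => sign_eq_neg_one_iff.2 ?_
        have h0 : fiberEval p (z.1, ξ z.1) ≤ 0 := by
          by_contra! hn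
          exact h ((hσ z.1 hz.1).symm.trans (sign_eq_one_iff.2 hn))
        exact (eval_lt_right_of_derivative_pos (hder' z.1 hz.1) hz.2).trans_le h0
  rcases hneg with hneg | hneg
  · rcases hpos with hpos | hpos
    · obtain ⟨η, hηc, hη⟩ := exists_continuousOn_root hloc hhic (continuous_fiberEval p)
        hmono hneg hpos
      refine Or.inr ⟨η, hηc, fun x hx => ⟨(hη x hx).1, fun y hy => ?_⟩⟩
      obtain ⟨hmem, h0⟩ := hη x hx
      rcases lt_trichotomy y (η x) with h | rfl | h
      · rw [sign_neg (sub_neg.2 h), sign_neg]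
        rw [← h0]
        exact hmono x hx hy hmem h
      · rw [h0, sub_self]
      · rw [sign_pos (sub_pos.2 h), sign_pos]
        rw [← h0]
        exact hmono x hx hmem hy h
    · exact Or.inl ⟨-1, hpos⟩
  · exact Or.inl ⟨1, hneg⟩

theorem sign_const_or_exists_root {n : ℕ} {B : Set (Fin n → ℝ)} (hB : B.Nonempty)
    {lo hi : (Fin n → ℝ) → EReal} {p : (MvPolynomial (Fin n) ℝ)[X]}
    (hloc : ContinuousOn lo B) (hhic : ContinuousOn hi B) (hlt : ∀ x ∈ B, lo x < hi x)
    (hlo : (lo = fun _ => ⊥) ∨ ∃ ξ : (Fin n → ℝ) → ℝ, (lo = fun x => (ξ x : EReal)) ∧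
      ∃ σ : SignType, ∀ x ∈ B, SignType.sign (fiberEval p (x, ξ x)) = σ)
    (hhi : (hi = fun _ => ⊤) ∨ ∃ ξ : (Fin n → ℝ) → ℝ, (hi = fun x => (ξ x : EReal)) ∧
      ∃ σ : SignType, ∀ x ∈ B, SignType.sign (fiberEval p (x, ξ x)) = σ)
    (hdeg : 0 < p.natDegree) (hlc : ∀ x ∈ B, MvPolynomial.eval x p.leadingCoeff ≠ 0)
    (hder : ∃ σ : SignType, ∀ z ∈ bandSet B lo hi,
      SignType.sign (fiberEval (derivative p) z) = σ) :
    (∃ σ : SignType, ∀ z ∈ bandSet B lo hi, SignType.sign (fiberEval p z) = σ) ∨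
      ∃ τ : SignType, τ ≠ 0 ∧ ∃ η : (Fin n → ℝ) → ℝ, ContinuousOn η B ∧
        ∀ x ∈ B, η x ∈ slice (lo x) (hi x) ∧ ∀ y ∈ slice (lo x) (hi x),
          SignType.sign (fiberEval p (x, y)) = τ * SignType.sign (y - η x) := by
  obtain ⟨σ, hσ⟩ := hder
  rcases SignType.trichotomy σ with rfl | rfl | rfl
  · have hneg : ∀ (z : (Fin n → ℝ) × ℝ) (σ : SignType),
        SignType.sign (fiberEval p z) = σ → SignType.sign (fiberEval (-p) z) = -σ := by
      intro z σ h
      rw [fiberEval_neg, Left.sign_neg, h]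
    rcases sign_const_or_exists_root_of_derivative_pos (p := -p) hloc hhic hlt
      (hlo.imp_right fun ⟨ξ, h, σ, hσ⟩ => ⟨ξ, h, -σ, fun x hx => hneg _ _ (hσ x hx)⟩)
      (hhi.imp_right fun ⟨ξ, h, σ, hσ⟩ => ⟨ξ, h, -σ, fun x hx => hneg _ _ (hσ x hx)⟩)
      (by simpa using hdeg) (fun x hx => by simpa using hlc x hx) (fun z hz => by
        rw [derivative_neg, fiberEval_neg, neg_pos]
        exact sign_eq_neg_one_iff.1 (hσ z hz)) with ⟨σ, h⟩ | ⟨η, hηc, hη⟩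
    · refine Or.inl ⟨-σ, fun z hz => ?_⟩
      rw [← h z hz, fiberEval_neg, Left.sign_neg, neg_neg]
    · refine Or.inr ⟨-1, by decide, η, hηc, fun x hx => ⟨(hη x hx).1, fun y hy => ?_⟩⟩
      rw [← (hη x hx).2 y hy, fiberEval_neg, Left.sign_neg, neg_one_mul, neg_neg]
  · obtain ⟨x, hx⟩ := hB
    have hzero : derivative (p.map (MvPolynomial.eval x)) = 0 := by
      refine eq_zero_of_infinite_isRoot _ ((infinite_slice (hlt x hx)).mono fun y hy => ?_)
      rw [derivative_map]
      exact sign_eq_zero_iff.1 (hσ (x, y) ⟨hx, hy⟩)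
    have h1 := derivative_eq_zero.1 hzero
    have h2 := natDegree_pos_iff_degree_pos.2 (degree_map_eval_pos hdeg (hlc x hx))
    omega
  · rcases sign_const_or_exists_root_of_derivative_pos hloc hhic hlt hlo hhi hdeg hlc
      (fun z hz => sign_eq_one_iff.1 (hσ z hz)) with h | ⟨η, hηc, hη⟩
    · exact Or.inl h
    · exact Or.inr ⟨1, by decide, η, hηc, fun x hx => ⟨(hη x hx).1, fun y hy => by
        rw [(hη x hx).2 y hy, one_mul]⟩⟩

/-- `S` is a finite disjoint union of cells over `B`. -/
def HasCellDecomposition {n : ℕ} (B : Set (Fin n → ℝ)) (G : Set (MvPolynomial (Fin n) ℝ)[X])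
    (S : Set ((Fin n → ℝ) × ℝ)) : Prop :=
  ∃ 𝒞 : Set (Set ((Fin n → ℝ) × ℝ)), 𝒞.Finite ∧ (∀ T ∈ 𝒞, IsCell B G T) ∧
    𝒞.PairwiseDisjoint id ∧ ⋃₀ 𝒞 = S

theorem IsCell.hasCellDecomposition {n : ℕ} {B : Set (Fin n → ℝ)}
    {G : Set (MvPolynomial (Fin n) ℝ)[X]} {S : Set ((Fin n → ℝ) × ℝ)} (h : IsCell B G S) :
    HasCellDecomposition B G S :=
  ⟨{S}, Set.finite_singleton S, by simpa using h, Set.pairwiseDisjoint_singleton _ _,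
    Set.sUnion_singleton S⟩

theorem HasCellDecomposition.refine {n : ℕ} {B : Set (Fin n → ℝ)}
    {G G' : Set (MvPolynomial (Fin n) ℝ)[X]} {S : Set ((Fin n → ℝ) × ℝ)}
    (h : HasCellDecomposition B G S) (h' : ∀ T, IsCell B G T → HasCellDecomposition B G' T) :
    HasCellDecomposition B G' S := by
  obtain ⟨𝒞, hfin, hcell, hdisj, rfl⟩ := h
  choose! D hDfin hDcell hDdisj hDunion using fun T (hT : T ∈ 𝒞) => h' T (hcell T hT)
  refine ⟨⋃ T ∈ 𝒞, D T, hfin.biUnion hDfin, ?_, ?_, ?_⟩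
  · intro U hU
    obtain ⟨T, hT, hU⟩ := Set.mem_iUnion₂.1 hU
    exact hDcell T hT U hU
  · intro U hU V hV hUV
    obtain ⟨T, hT, hU⟩ := Set.mem_iUnion₂.1 hU
    obtain ⟨T', hT', hV⟩ := Set.mem_iUnion₂.1 hV
    by_cases hTT : T = T'
    · subst hTT
      exact hDdisj T hT hU hV hUV
    · refine (hdisj hT hT' hTT).mono ?_ ?_
      · rw [id, id, ← hDunion T hT]
        exact Set.subset_sUnion_of_mem hU
      · rw [id, id, ← hDunion T' hT']
        exact Set.subset_sUnion_of_mem hV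
  · simp only [Set.sUnion_iUnion]
    rw [Set.iUnion₂_congr hDunion, Set.sUnion_eq_biUnion]

/-- A root section running inside a band splits it into three cells. -/
theorem IsBand.hasCellDecomposition_of_mem_slice {n : ℕ} {B : Set (Fin n → ℝ)}
    {G : Set (MvPolynomial (Fin n) ℝ)[X]} {lo hi : (Fin n → ℝ) → EReal} {η : (Fin n → ℝ) → ℝ}
    (hlo : IsLowerEnd B G lo) (hhi : IsUpperEnd B G hi) (hη : IsRootSection B G η)
    (hmem : ∀ x ∈ B, η x ∈ slice (lo x) (hi x))
    (hsl : SignConstOn G (bandSet B lo fun x => (η x : EReal)))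
    (hsr : SignConstOn G (bandSet B (fun x => (η x : EReal)) hi)) :
    HasCellDecomposition B G (bandSet B lo hi) := by
  refine ⟨{sectionSet B η, bandSet B lo fun x => (η x : EReal),
    bandSet B (fun x => (η x : EReal)) hi}, by simp, ?_, ?_, ?_⟩
  · rintro T (rfl | rfl | rfl)
    · exact Or.inl ⟨η, hη, rfl⟩
    · exact Or.inr ⟨_, _, ⟨hlo, Or.inr ⟨η, hη, rfl⟩, fun x hx => (hmem x hx).1, hsl⟩, rfl⟩
    · exact Or.inr ⟨_, _, ⟨Or.inr ⟨η, hη, rfl⟩, hhi, fun x hx => (hmem x hx).2, hsr⟩, rfl⟩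
  · have h1 : Disjoint (sectionSet B η) (bandSet B lo fun x => (η x : EReal)) :=
      Set.disjoint_left.2 fun z hz hz' =>
        (EReal.coe_lt_coe_iff.1 hz'.2.2).ne hz.2
    have h2 : Disjoint (sectionSet B η) (bandSet B (fun x => (η x : EReal)) hi) :=
      Set.disjoint_left.2 fun z hz hz' =>
        (EReal.coe_lt_coe_iff.1 hz'.2.1).ne' hz.2
    have h3 : Disjoint (bandSet B lo fun x => (η x : EReal))
        (bandSet B (fun x => (η x : EReal)) hi) :=
      Set.disjoint_left.2 fun z hz hz' => hz.2.2.not_gt hz'.2.1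
    rintro U (rfl | rfl | rfl) V (rfl | rfl | rfl) hUV
    exacts [absurd rfl hUV, h1, h2, h1.symm, absurd rfl hUV, h3, h2.symm, h3.symm,
      absurd rfl hUV]
  · ext ⟨x, y⟩
    simp only [Set.sUnion_insert, Set.sUnion_singleton, Set.mem_union]
    constructor
    · rintro (⟨hx, hy⟩ | ⟨hx, hy⟩ | ⟨hx, hy⟩)
      · exact ⟨hx, (show y = η x from hy) ▸ hmem x hx⟩
      · exact ⟨hx, hy.1, hy.2.trans (hmem x hx).2⟩
      · exact ⟨hx, (hmem x hx).1.trans hy.1, hy.2⟩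
    · rintro ⟨hx, hy⟩
      rcases lt_trichotomy y (η x) with h | h | h
      · exact Or.inr (Or.inl ⟨hx, hy.1, EReal.coe_lt_coe_iff.2 h⟩)
      · exact Or.inl ⟨hx, h⟩
      · exact Or.inr (Or.inr ⟨hx, EReal.coe_lt_coe_iff.2 h, hy.2⟩)

theorem IsCell.hasCellDecomposition_insert {n : ℕ} {B : Set (Fin n → ℝ)}
    (hBsa : IsSemialgebraic B) (hB : B.Nonempty) {G : Set (MvPolynomial (Fin n) ℝ)[X]}
    {S : Set ((Fin n → ℝ) × ℝ)} (h : IsCell B G S) {p : (MvPolynomial (Fin n) ℝ)[X]}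
    (hder : 0 < p.natDegree → derivative p ∈ G) (herase : 0 < p.natDegree → p.eraseLead ∈ G)
    (hrem : ∀ q ∈ G, 0 < q.natDegree → pseudoRem p q ∈ G)
    (hlc : ∀ q ∈ insert p G, ∃ σ : SignType, ∀ x ∈ B,
      SignType.sign (MvPolynomial.eval x q.leadingCoeff) = σ) :
    HasCellDecomposition B (insert p G) S := by
  have hsec : ∀ ξ, IsRootSection B G ξ → IsRootSection B (insert p G) ξ := fun ξ hξ =>
    hξ.insert hrem fun q hq => hlc q (Set.mem_insert_of_mem _ hq)
  rcases h with ⟨ξ, hξ, rfl⟩ | ⟨lo, hi, hb, rfl⟩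
  · exact IsCell.hasCellDecomposition (Or.inl ⟨ξ, hsec ξ hξ, rfl⟩)
  have hlo : IsLowerEnd B (insert p G) lo :=
    hb.lower.imp_right fun ⟨ξ, hξ, h⟩ => ⟨ξ, hsec ξ hξ, h⟩
  have hhi : IsUpperEnd B (insert p G) hi :=
    hb.upper.imp_right fun ⟨ξ, hξ, h⟩ => ⟨ξ, hsec ξ hξ, h⟩
  have hconst : (∃ σ : SignType, ∀ z ∈ bandSet B lo hi, SignType.sign (fiberEval p z) = σ) →
      HasCellDecomposition B (insert p G) (bandSet B lo hi) := fun ⟨σ, hσ⟩ =>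
    IsCell.hasCellDecomposition (Or.inr ⟨lo, hi, ⟨hlo, hhi, hb.lt, hb.sign.insert hσ⟩, rfl⟩)
  obtain ⟨σ, hσ⟩ := hlc p (Set.mem_insert _ _)
  rcases Nat.eq_zero_or_pos p.natDegree with hdeg | hdeg
  · refine hconst ⟨σ, fun z hz => ?_⟩
    rw [fiberEval_of_natDegree_eq_zero hdeg, hσ z.1 hz.1]
  by_cases hσ0 : σ = 0
  · obtain ⟨τ, hτ⟩ := hb.sign _ (herase hdeg)
    refine hconst ⟨τ, fun z hz => ?_⟩
    rw [← hτ z hz, fiberEval_eraseLead]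
    exact sign_eq_zero_iff.1 ((hσ z.1 hz.1).trans hσ0)
  have hlc0 : ∀ x ∈ B, MvPolynomial.eval x p.leadingCoeff ≠ 0 := fun x hx => by
    rw [← sign_ne_zero, hσ x hx]
    exact hσ0
  have hend : ∀ ξ, IsRootSection B (insert p G) ξ →
      ∃ σ : SignType, ∀ x ∈ B, SignType.sign (fiberEval p (x, ξ x)) = σ := fun ξ hξ =>
    let ⟨σ, hσ⟩ := hξ.sign p (Set.mem_insert _ _)
    ⟨σ, fun x hx => hσ (x, ξ x) ⟨hx, rfl⟩⟩
  rcases sign_const_or_exists_root hB hlo.continuousOn hhi.continuousOn hb.lt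
    (hlo.imp_right fun ⟨ξ, hξ, h⟩ => ⟨ξ, h, hend ξ hξ⟩)
    (hhi.imp_right fun ⟨ξ, hξ, h⟩ => ⟨ξ, h, hend ξ hξ⟩) hdeg hlc0
    (hb.sign _ (hder hdeg)) with h | ⟨τ, hτ0, η, hηc, hη⟩
  · exact hconst h
  have hmem : ∀ x ∈ B, η x ∈ slice (lo x) (hi x) := fun x hx => (hη x hx).1
  have hsign : ∀ z ∈ bandSet B lo hi,
      SignType.sign (fiberEval p z) = τ * SignType.sign (z.2 - η z.1) :=
    fun z hz => (hη z.1 hz.1).2 z.2 hz.2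
  have hlt_iff : ∀ z ∈ bandSet B lo hi,
      (SignType.sign (fiberEval p z) = -τ ↔ z.2 < η z.1) := fun z hz => by
    rw [hsign z hz, ← sub_neg, ← sign_eq_neg_one_iff]
    revert hτ0
    generalize SignType.sign (z.2 - η z.1) = s
    clear * -
    revert s τ
    decide
  have hgt_iff : ∀ z ∈ bandSet B lo hi,
      (SignType.sign (fiberEval p z) = τ ↔ η z.1 < z.2) := fun z hz => by
    rw [hsign z hz, ← sub_pos, ← sign_eq_one_iff]
    revert hτ0
    generalize SignType.sign (z.2 - η z.1) = s
    clear * -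
    revert s τ
    decide
  have hbsa := hb.isSemialgebraicProd hBsa
  have hsub : sectionSet B η ⊆ bandSet B lo hi := by
    rintro ⟨x, y⟩ ⟨hx, hy⟩
    exact ⟨hx, (show y = η x from hy) ▸ hmem x hx⟩
  have hleft : bandSet B lo (fun x => (η x : EReal)) ⊆ bandSet B lo hi :=
    fun z hz => ⟨hz.1, hz.2.1, hz.2.2.trans (hmem z.1 hz.1).2⟩
  have hright : bandSet B (fun x => (η x : EReal)) hi ⊆ bandSet B lo hi :=
    fun z hz => ⟨hz.1, (hmem z.1 hz.1).1.trans hz.2.1, hz.2.2⟩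
  have hroot : ∀ z ∈ sectionSet B η, SignType.sign (fiberEval p z) = 0 := by
    intro z hz
    rw [hsign z (hsub hz), hz.2, sub_self, sign_zero, mul_zero]
  have hηsec : IsRootSection B (insert p G) η := by
    refine ⟨hηc, ?_, ?_, ⟨p, Set.mem_insert _ _, hdeg, fun x hx => ⟨hlc0 x hx,
      sign_eq_zero_iff.1 (hroot (x, η x) ⟨hx, rfl⟩)⟩⟩, (hb.sign.mono hsub).insert hroot⟩
    · convert (hBsa.cylinder.diff (hb.lower.isSemialgebraicProd hBsa)).union
        (hbsa.inter (isSemialgebraicProd_sign_eq p (-τ))) using 1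
      ext z
      constructor
      · rintro ⟨hx, hy⟩
        by_cases hz : lo z.1 < z.2
        · have hzb : z ∈ bandSet B lo hi :=
            ⟨hx, hz, (EReal.coe_lt_coe_iff.2 hy).trans (hmem z.1 hx).2⟩
          exact Or.inr ⟨hzb, (hlt_iff z hzb).2 hy⟩
        · exact Or.inl ⟨hx, fun h => hz h.2⟩
      · rintro (⟨hx, hz⟩ | ⟨hzb, hz⟩)
        · refine ⟨hx, EReal.coe_lt_coe_iff.1 (lt_of_le_of_lt ?_ (hmem z.1 hx).1)⟩
          exact not_lt.1 fun h => hz ⟨hx, h⟩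
        · exact ⟨hzb.1, (hlt_iff z hzb).1 hz⟩
    · convert (hBsa.cylinder.diff (hb.upper.isSemialgebraicProd hBsa)).union
        (hbsa.inter (isSemialgebraicProd_sign_eq p τ)) using 1
      ext z
      constructor
      · rintro ⟨hx, hy⟩
        by_cases hz : z.2 < hi z.1
        · have hzb : z ∈ bandSet B lo hi :=
            ⟨hx, (hmem z.1 hx).1.trans (EReal.coe_lt_coe_iff.2 hy), hz⟩
          exact Or.inr ⟨hzb, (hgt_iff z hzb).2 hy⟩
        · exact Or.inl ⟨hx, fun h => hz h.2⟩
      · rintro (⟨hx, hz⟩ | ⟨hzb, hz⟩)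
        · refine ⟨hx, EReal.coe_lt_coe_iff.1 (lt_of_lt_of_le (hmem z.1 hx).2 ?_)⟩
          exact not_lt.1 fun h => hz ⟨hx, h⟩
        · exact ⟨hzb.1, (hgt_iff z hzb).1 hz⟩
  refine IsBand.hasCellDecomposition_of_mem_slice hlo hhi hηsec hmem ?_ ?_
  · exact (hb.sign.mono hleft).insert fun z hz =>
      (hlt_iff z (hleft hz)).2 (EReal.coe_lt_coe_iff.1 hz.2.2)
  · exact (hb.sign.mono hright).insert fun z hz =>
      (hgt_iff z (hright hz)).2 (EReal.coe_lt_coe_iff.1 hz.2.1)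

theorem hasCellDecomposition_cylinder {n : ℕ} {B : Set (Fin n → ℝ)}
    (hBsa : IsSemialgebraic B) (hB : B.Nonempty) (F : Finset (MvPolynomial (Fin n) ℝ)[X])
    (hred : reducts (F : Set (MvPolynomial (Fin n) ℝ)[X]) ⊆ F)
    (hlc : ∀ q ∈ F, ∃ σ : SignType, ∀ x ∈ B,
      SignType.sign (MvPolynomial.eval x q.leadingCoeff) = σ) :
    HasCellDecomposition B (F : Set (MvPolynomial (Fin n) ℝ)[X]) {z | z.1 ∈ B} := by
  classical
  revert hred hlc
  refine Finset.induction_on_max_value natDegree F ?_ ?_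
  · intro _ _
    refine IsCell.hasCellDecomposition (Or.inr ⟨fun _ => ⊥, fun _ => ⊤,
      ⟨Or.inl rfl, Or.inl rfl, fun _ _ => bot_lt_top, fun g hg => by simp at hg⟩, ?_⟩)
    ext z
    simp [bandSet, slice, EReal.bot_lt_coe, EReal.coe_lt_top]
  · intro p G hp hmax ih hred hlc
    rw [Finset.coe_insert] at hred ⊢
    have hmem : ∀ r ∈ reducts (insert p (G : Set (MvPolynomial (Fin n) ℝ)[X])),
        r.natDegree < p.natDegree → r ∈ (G : Set (MvPolynomial (Fin n) ℝ)[X]) := by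
      intro r hr hlt
      rcases hred hr with rfl | h
      · exact absurd hlt (lt_irrefl _)
      · exact h
    have hredG : reducts (G : Set (MvPolynomial (Fin n) ℝ)[X]) ⊆ G := by
      intro r hr
      refine hmem r (reducts_mono (Set.subset_insert _ _) hr) ?_
      rcases mem_reducts_sep_natDegree_lt hr with ⟨q, hq, -⟩ | ⟨q, hq, -⟩ <;>
        exact hq.2.trans_le (hmax q hq.1)
    have hpG := Set.mem_insert p (G : Set (MvPolynomial (Fin n) ℝ)[X])
    refine (ih hredG fun q hq => hlc q (Finset.mem_insert_of_mem hq)).refine fun T hT => ?_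
    refine hT.hasCellDecomposition_insert hBsa hB ?_ ?_ ?_ ?_
    · exact fun h0 => hmem _ (Or.inl ⟨p, hpG, h0, Or.inl rfl⟩) (natDegree_derivative_lt h0.ne')
    · exact fun h0 => hmem _ (Or.inl ⟨p, hpG, h0, Or.inr rfl⟩) (natDegree_eraseLead_lt_of_pos h0)
    · intro q hq h0
      exact hmem _ (Or.inr ⟨p, hpG, q, Set.mem_insert_of_mem _ hq, h0, hmax q hq, rfl⟩)
        ((natDegree_pseudoRem_lt p h0).trans_le (hmax q hq))
    · intro q hq
      exact hlc q (by simpa using hq)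

end Splitting

section CylindricalDecomposition

open Polynomial

/-- `S` is a finite union of connected semialgebraic sets. -/
def HasConnectedDecomposition {n : ℕ} (S : Set (Fin n → ℝ)) : Prop :=
  ∃ 𝒞 : Set (Set (Fin n → ℝ)), 𝒞.Finite ∧
    (∀ T ∈ 𝒞, IsSemialgebraic T ∧ IsPreconnected T) ∧ ⋃₀ 𝒞 = S

theorem exists_cylindrical_decomposition {n : ℕ}
    (hconn : ∀ S : Set (Fin n → ℝ), IsSemialgebraic S → HasConnectedDecomposition S)
    {L : Set (MvPolynomial (Fin n) ℝ)[X]} (hL : L.Finite) :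
    ∃ F : Set (MvPolynomial (Fin n) ℝ)[X], L ⊆ F ∧ ∃ 𝓑 : Set (Set (Fin n → ℝ)), 𝓑.Finite ∧
      ⋃₀ 𝓑 = Set.univ ∧ ∀ B ∈ 𝓑, IsSemialgebraic B ∧ IsPreconnected B ∧ B.Nonempty ∧
        HasCellDecomposition B F {z | z.1 ∈ B} := by
  obtain ⟨F, hF, hLF, hred⟩ := exists_finite_reducts_subset hL
  lift F to Finset (MvPolynomial (Fin n) ℝ)[X] using hF
  let A : (F → SignType) → Set (Fin n → ℝ) := fun σ =>
    ⋂ q ∈ (Set.univ : Set F), {x | SignType.sign (MvPolynomial.eval x q.1.leadingCoeff) = σ q}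
  have hA : ∀ σ, IsSemialgebraic (A σ) := fun σ =>
    IsSemialgebraic.biInter Set.finite_univ fun q _ => isSemialgebraic_sign_eq _ _
  choose 𝒞 hfin hcell hunion using fun σ => hconn (A σ) (hA σ)
  refine ⟨F, hLF, {B ∈ ⋃ σ, 𝒞 σ | B.Nonempty},
    (Set.finite_iUnion hfin).subset (Set.sep_subset _ _), ?_, ?_⟩
  · refine Set.eq_univ_of_forall fun x => ?_
    let σ : F → SignType := fun q => SignType.sign (MvPolynomial.eval x q.1.leadingCoeff)
    have hx : x ∈ ⋃₀ 𝒞 σ := by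
      rw [hunion σ]
      exact Set.mem_iInter₂.2 fun q _ => rfl
    obtain ⟨B, hB, hxB⟩ := hx
    exact ⟨B, ⟨Set.mem_iUnion.2 ⟨σ, hB⟩, x, hxB⟩, hxB⟩
  · rintro B ⟨hB, hne⟩
    obtain ⟨σ, hB⟩ := Set.mem_iUnion.1 hB
    obtain ⟨hsa, hpc⟩ := hcell σ B hB
    refine ⟨hsa, hpc, hne, hasCellDecomposition_cylinder hsa hne F hred ?_⟩
    intro q hq
    refine ⟨σ ⟨q, hq⟩, fun x hx => ?_⟩
    have hxA : x ∈ A σ := hunion σ ▸ Set.mem_sUnion_of_mem hx hB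
    exact Set.mem_iInter₂.1 hxA ⟨q, hq⟩ (Set.mem_univ _)

/-- A semialgebraic set is a union of sign classes of finitely many polynomials. -/
theorem IsSemialgebraic.exists_finite_sign {n : ℕ} {S : Set (Fin n → ℝ)}
    (hS : IsSemialgebraic S) :
    ∃ Q : Set (MvPolynomial (Fin n) ℝ), Q.Finite ∧ ∀ T : Set (Fin n → ℝ),
      (∀ p ∈ Q, ∃ σ : SignType, ∀ x ∈ T, SignType.sign (MvPolynomial.eval x p) = σ) →
        T ⊆ S ∨ Disjoint T S := by
  induction hS with
  | zero_set p =>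
    refine ⟨{p}, Set.finite_singleton p, fun T hT => ?_⟩
    obtain ⟨σ, hσ⟩ := hT p rfl
    by_cases h : σ = 0
    · exact Or.inl fun x hx => sign_eq_zero_iff.1 ((hσ x hx).trans h)
    · exact Or.inr (Set.disjoint_left.2 fun x hx hx' =>
        h ((hσ x hx).symm.trans (sign_eq_zero_iff.2 hx')))
  | pos_set p =>
    refine ⟨{p}, Set.finite_singleton p, fun T hT => ?_⟩
    obtain ⟨σ, hσ⟩ := hT p rfl
    by_cases h : σ = 1
    · exact Or.inl fun x hx => sign_eq_one_iff.1 ((hσ x hx).trans h)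
    · exact Or.inr (Set.disjoint_left.2 fun x hx hx' =>
        h ((hσ x hx).symm.trans (sign_eq_one_iff.2 hx')))
  | union _ _ h₁ h₂ =>
    obtain ⟨Q₁, hQ₁, h₁⟩ := h₁
    obtain ⟨Q₂, hQ₂, h₂⟩ := h₂
    refine ⟨Q₁ ∪ Q₂, hQ₁.union hQ₂, fun T hT => ?_⟩
    rcases h₁ T fun p hp => hT p (Or.inl hp) with h | h
    · exact Or.inl (h.trans Set.subset_union_left)
    · rcases h₂ T fun p hp => hT p (Or.inr hp) with h' | h'
      · exact Or.inl (h'.trans Set.subset_union_right)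
      · exact Or.inr (Set.disjoint_union_right.2 ⟨h, h'⟩)
  | compl _ h =>
    obtain ⟨Q, hQ, h⟩ := h
    refine ⟨Q, hQ, fun T hT => ?_⟩
    rcases h T hT with h | h
    · exact Or.inr (Set.disjoint_compl_right_iff_subset.2 h)
    · exact Or.inl (Set.subset_compl_iff_disjoint_right.2 h)

theorem isPreconnected_preimage_init_last {n : ℕ} {S : Set ((Fin n → ℝ) × ℝ)}
    (hS : IsPreconnected S) :
    IsPreconnected {w : Fin (n + 1) → ℝ | (Fin.init w, w (Fin.last n)) ∈ S} := by
  have : {w : Fin (n + 1) → ℝ | (Fin.init w, w (Fin.last n)) ∈ S}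
      = (fun z : (Fin n → ℝ) × ℝ => (Fin.snoc z.1 z.2 : Fin (n + 1) → ℝ)) '' S := by
    ext w
    constructor
    · exact fun hw => ⟨_, hw, Fin.snoc_init_self w⟩
    · rintro ⟨z, hz, rfl⟩
      simpa using hz
  rw [this]
  exact hS.image _ (Continuous.finSnoc (A := fun _ => ℝ) continuous_fst continuous_snd).continuousOn

theorem IsSemialgebraic.hasConnectedDecomposition {n : ℕ} {S : Set (Fin n → ℝ)}
    (hS : IsSemialgebraic S) : HasConnectedDecomposition S := by
  induction n with
  | zero =>
    exact ⟨{S}, Set.finite_singleton S, by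
      rintro T rfl
      exact ⟨hS, Set.subsingleton_of_subsingleton.isPreconnected⟩, Set.sUnion_singleton S⟩
  | succ n ih =>
    obtain ⟨Q, hQ, hQS⟩ := hS.exists_finite_sign
    choose φ hφ using fun P : MvPolynomial (Fin (n + 1)) ℝ => exists_fiberEval_eq_eval P
    obtain ⟨F, hLF, 𝓑, h𝓑, hcover, hdec⟩ :=
      exists_cylindrical_decomposition (fun _ h => ih h) (hQ.image φ)
    choose! hsa hpc hne 𝒞 hfin hcell _ hunion using hdec
    let pull : Set ((Fin n → ℝ) × ℝ) → Set (Fin (n + 1) → ℝ) := fun T =>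
      {w | (Fin.init w, w (Fin.last n)) ∈ T}
    refine ⟨{T ∈ pull '' ⋃ B ∈ 𝓑, 𝒞 B | T ⊆ S},
      ((h𝓑.biUnion hfin).image pull).subset (Set.sep_subset _ _), ?_, ?_⟩
    · rintro _ ⟨⟨T, hT, rfl⟩, -⟩
      obtain ⟨B, hB, hT⟩ := Set.mem_iUnion₂.1 hT
      exact ⟨(hcell B hB T hT).isSemialgebraicProd (hsa B hB),
        isPreconnected_preimage_init_last ((hcell B hB T hT).isPreconnected (hpc B hB))⟩
    · refine Set.Subset.antisymm (Set.sUnion_subset fun T hT => hT.2) fun w hw => ?_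
      obtain ⟨B, hB, hwB⟩ : Fin.init w ∈ ⋃₀ 𝓑 := hcover ▸ Set.mem_univ _
      obtain ⟨T, hT, hwT⟩ : (Fin.init w, w (Fin.last n)) ∈ ⋃₀ 𝒞 B := by
        rw [hunion B hB]
        exact hwB
      refine ⟨pull T, ⟨⟨T, Set.mem_iUnion₂.2 ⟨B, hB, hT⟩, rfl⟩, ?_⟩, hwT⟩
      rcases hQS (pull T) (fun P hP => by
        obtain ⟨σ, hσ⟩ := (hcell B hB T hT).signConstOn (φ P) (hLF ⟨P, hP, rfl⟩)
        refine ⟨σ, fun v hv => ?_⟩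
        have := hσ _ hv
        rwa [hφ, Fin.snoc_init_self] at this) with h | h
      · exact h
      · exact absurd hw (Set.disjoint_left.1 h hwT)

end CylindricalDecomposition

section Branch

open Polynomial

/-- Over a connected base, a continuous function whose graph avoids the bands of a cell
decomposition coincides with one of its root sections. -/
theorem HasCellDecomposition.exists_eqOn {n : ℕ} {B : Set (Fin n → ℝ)}
    {G : Set (MvPolynomial (Fin n) ℝ)[X]} (h : HasCellDecomposition B G {z | z.1 ∈ B})
    (hB : IsPreconnected B) (hne : B.Nonempty) {f : (Fin n → ℝ) → ℝ} (hf : Continuous f)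
    (hband : ∀ lo hi, IsBand B G lo hi → ∀ x ∈ B, f x ∉ slice (lo x) (hi x)) :
    ∃ ξ, IsRootSection B G ξ ∧ Set.EqOn f ξ B := by
  obtain ⟨𝒞, hfin, hcell, hdisj, hunion⟩ := h
  have hex : ∀ x ∈ B, ∃ T ∈ 𝒞, (x, f x) ∈ T := fun x hx => by
    have : (x, f x) ∈ ⋃₀ 𝒞 := hunion ▸ hx
    exact this
  have hsec : ∀ T ∈ 𝒞, ∀ x ∈ B, (x, f x) ∈ T → ∃ ξ, IsRootSection B G ξ ∧ T = sectionSet B ξ := by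
    intro T hT x hx hxT
    rcases hcell T hT with h | ⟨lo, hi, hb, rfl⟩
    · exact h
    · exact absurd hxT.2 (hband lo hi hb x hx)
  have hclosed : ∀ T ∈ 𝒞, IsClosed {b : B | (b.1, f b.1) ∈ T} := by
    intro T hT
    rcases Set.eq_empty_or_nonempty {b : B | (b.1, f b.1) ∈ T} with h | ⟨b, hb⟩
    · rw [h]
      exact isClosed_empty
    · obtain ⟨ξ, hξ, rfl⟩ := hsec T hT b.1 b.2 hb
      have : {b : B | (b.1, f b.1) ∈ sectionSet B ξ} = {b : B | f b.1 = B.domRestrict ξ b} := by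
        ext b
        exact ⟨fun h => h.2, fun h => ⟨b.2, h⟩⟩
      rw [this]
      exact isClosed_eq (hf.comp continuous_subtype_val) hξ.continuousOn.domRestrict
  obtain ⟨x₀, hx₀⟩ := hne
  obtain ⟨T₀, hT₀, hmem₀⟩ := hex x₀ hx₀
  have hcompl : {b : B | (b.1, f b.1) ∈ T₀}ᶜ
      = ⋃ T ∈ 𝒞 \ {T₀}, {b : B | (b.1, f b.1) ∈ T} := by
    ext b
    simp only [Set.mem_iUnion₂]
    constructor
    · intro hb
      obtain ⟨T, hT, hbT⟩ := hex b.1 b.2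
      exact ⟨T, ⟨hT, fun h => hb ((show T = T₀ from h) ▸ hbT)⟩, hbT⟩
    · rintro ⟨T, ⟨hT, hne⟩, hbT⟩ hb
      exact Set.disjoint_left.1 (hdisj hT hT₀ hne) hbT hb
  have hclopen : IsClopen {b : B | (b.1, f b.1) ∈ T₀} := by
    refine ⟨hclosed T₀ hT₀, isClosed_compl_iff.1 ?_⟩
    rw [hcompl]
    exact (hfin.subset Set.sdiff_subset).isClosed_biUnion fun T hT => hclosed T hT.1
  have : PreconnectedSpace B := Subtype.preconnectedSpace hB
  have huniv := hclopen.eq_univ ⟨⟨x₀, hx₀⟩, hmem₀⟩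
  obtain ⟨ξ, hξ, rfl⟩ := hsec T₀ hT₀ x₀ hx₀ hmem₀
  refine ⟨ξ, hξ, fun x hx => ?_⟩
  have : (⟨x, hx⟩ : B) ∈ {b : B | (b.1, f b.1) ∈ sectionSet B ξ} := huniv ▸ Set.mem_univ _
  exact this.2

end Branch

/-- If `f : ℝⁿ → ℝ` is continuous and its graph lies in the zero set of a polynomial
`P ∈ ℝ[X₁,…,Xₙ,Y]` such that for each `x` the univariate polynomial `P(x, ·)` is nonzero
(equivalently, over the infinite field `ℝ`, not identically zero as a function of `y`),
then `f` is semialgebraic. -/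
theorem statement15 {n : ℕ} (f : (Fin n → ℝ) → ℝ) (hf : Continuous f)
    (P : MvPolynomial (Fin (n + 1)) ℝ)
    (hgraph : ∀ x : Fin n → ℝ, MvPolynomial.eval (Fin.snoc x (f x)) P = 0)
    (hfib : ∀ x : Fin n → ℝ, ∃ y : ℝ, MvPolynomial.eval (Fin.snoc x y) P ≠ 0) :
    IsSemialgebraic (graphOn f Set.univ) := by
  obtain ⟨p, hp⟩ := exists_fiberEval_eq_eval P
  obtain ⟨F, hpF, 𝓑, h𝓑, hcover, hdec⟩ := exists_cylindrical_decomposition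
    (fun _ h => h.hasConnectedDecomposition) (Set.finite_singleton p)
  have hgraphB : graphOn f Set.univ = ⋃ B ∈ 𝓑,
      {w : Fin (n + 1) → ℝ | (Fin.init w, w (Fin.last n)) ∈ sectionSet B f} := by
    ext w
    simp only [Set.mem_iUnion₂]
    constructor
    · rintro ⟨x, -, rfl⟩
      obtain ⟨B, hB, hxB⟩ : x ∈ ⋃₀ 𝓑 := hcover ▸ Set.mem_univ x
      exact ⟨B, hB, by simpa [sectionSet] using hxB⟩
    · rintro ⟨B, -, hw⟩
      refine ⟨Fin.init w, Set.mem_univ _, ?_⟩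
      rw [← show w (Fin.last n) = f (Fin.init w) from hw.2, Fin.snoc_init_self]
  rw [hgraphB]
  refine IsSemialgebraic.biUnion h𝓑 fun B hB => ?_
  obtain ⟨hsa, hpc, hne, hcells⟩ := hdec B hB
  obtain ⟨ξ, hξ, heq⟩ := hcells.exists_eqOn hpc hne hf (by
    intro lo hi hb x hx hmem
    obtain ⟨σ, hσ⟩ := hb.sign p (hpF rfl)
    have hσ0 : σ = 0 := by
      rw [← hσ (x, f x) ⟨hx, hmem⟩, hp, hgraph, sign_zero]
    have hzero : p.map (MvPolynomial.eval x) = 0 :=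
      Polynomial.eq_zero_of_infinite_isRoot _ ((infinite_slice (hb.lt x hx)).mono fun y hy =>
        sign_eq_zero_iff.1 ((hσ (x, y) ⟨hx, hy⟩).trans hσ0))
    obtain ⟨y, hy⟩ := hfib x
    refine hy ?_
    rw [← hp (x, y), fiberEval, hzero, Polynomial.eval_zero])
  have hset : sectionSet B f = sectionSet B ξ := by
    ext z
    exact and_congr_right fun hz => by rw [heq hz]
  rw [hset]
  exact hξ.isSemialgebraicProd hsa
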